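/- arXiv:2604.02682 — 6 statements merged into one kernel-verified Lean document; each statement's English description precedes it below -/
import Mathlib

section
/- Let p be a prime number, n ≥ 1 a natural number, R a commutative ring and f ∈ R. The ring homomorphism W_n(R) → W_n(R[1/f]) induced by functoriality of truncated Witt vectors from the localization map R → R[1/f] sends the truncated Teichmüller representative [f] ∈ W_n(R) to a unit of W_n(R[1/f]), and the induced ring homomorphism W_n(R)[1/[f]] → W_n(R[1/f]) is bijective; equivalently, W_n(R[1/f]) is the localization of W_n(R) away from the element [f]. -/
/-- The ring homomorphism `W_n(R) →+* W_n(S)` induced, by functoriality of truncated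
Witt vectors, from a ring homomorphism `φ : R →+* S`. -/
noncomputable def truncatedWittVectorMap (p n : ℕ) [hp : Fact p.Prime]
    {R S : Type*} [CommRing R] [CommRing S] (φ : R →+* S) :
    TruncatedWittVector p n R →+* TruncatedWittVector p n S :=
  RingHom.liftOfRightInverse (WittVector.truncate n) TruncatedWittVector.out
    TruncatedWittVector.truncateFun_out
    ⟨(WittVector.truncate n).comp (WittVector.map φ), by
      intro x hx
      rw [WittVector.mem_ker_truncate] at hx
      rw [RingHom.mem_ker, RingHom.comp_apply, ← RingHom.mem_ker,
        WittVector.mem_ker_truncate]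
      intro i hi
      rw [WittVector.map_coeff, hx i hi, map_zero]⟩

namespace WittVector

section TeichmullerMul

variable {p : ℕ} [hp : Fact p.Prime]

theorem ghostComponent_mk_pow_mul {R : Type*} [CommRing R] (r : R) (x : WittVector p R)
    (n : ℕ) :
    ghostComponent n (mk p fun k => r ^ p ^ k * x.coeff k) =
      r ^ p ^ n * ghostComponent n x := by
  simp only [ghostComponent_apply, aeval_wittPolynomial, Finset.mul_sum]
  refine Finset.sum_congr rfl fun i hi => ?_
  have h : p ^ i * p ^ (n - i) = p ^ n := by
    rw [← pow_add, Nat.add_sub_cancel' (Finset.mem_range_succ_iff.mp hi)]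
  rw [coeff_mk, mul_pow, ← pow_mul, h]
  ring

theorem map_mk_pow_mul {R S : Type*} [CommRing R] [CommRing S] (φ : R →+* S) (r : R)
    (x : WittVector p R) :
    map φ (mk p fun k => r ^ p ^ k * x.coeff k) =
      mk p fun k => φ r ^ p ^ k * (map φ x).coeff k := by
  ext k
  simp [map_coeff]

/-- Multiplication by a Teichmüller representative scales the `k`-th coefficient by `r ^ p ^ k`. -/
theorem teichmuller_mul_eq_mk {R : Type*} [CommRing R] (r : R) (x : WittVector p R) :
    teichmuller p r * x = mk p fun k => r ^ p ^ k * x.coeff k := by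
  have rat (r : MvPolynomial R ℚ) (x : WittVector p (MvPolynomial R ℚ)) :
      teichmuller p r * x = mk p fun k => r ^ p ^ k * x.coeff k := by
    apply (ghostMap.bijective_of_invertible p (MvPolynomial R ℚ)).1
    ext1 n
    rw [map_mul, Pi.mul_apply, ghostMap_apply, ghostMap_apply, ghostMap_apply,
      ghostComponent_teichmuller, ghostComponent_mk_pow_mul]
  have int (r : MvPolynomial R ℤ) (x : WittVector p (MvPolynomial R ℤ)) :
      teichmuller p r * x = mk p fun k => r ^ p ^ k * x.coeff k := by
    refine map_injective (MvPolynomial.map (Int.castRingHom ℚ))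
      (MvPolynomial.map_injective _ Int.cast_injective) ?_
    rw [map_mul, map_teichmuller, rat, map_mk_pow_mul]
  obtain ⟨r, rfl⟩ := MvPolynomial.counit_surjective R r
  obtain ⟨x, rfl⟩ := map_surjective _ (MvPolynomial.counit_surjective R) x
  rw [← map_teichmuller, ← map_mul, int, map_mk_pow_mul]

theorem coeff_teichmuller_mul {R : Type*} [CommRing R] (r : R) (x : WittVector p R) (k : ℕ) :
    (teichmuller p r * x).coeff k = r ^ p ^ k * x.coeff k := by
  rw [teichmuller_mul_eq_mk, coeff_mk]

end TeichmullerMul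

end WittVector

section TruncatedMap

variable {p n : ℕ} [hp : Fact p.Prime] {R S : Type*} [CommRing R] [CommRing S]

theorem truncatedWittVectorMap_truncate (φ : R →+* S) (x : WittVector p R) :
    truncatedWittVectorMap p n φ (WittVector.truncate n x) =
      WittVector.truncate n (WittVector.map φ x) :=
  RingHom.liftOfRightInverse_comp_apply (WittVector.truncate n) TruncatedWittVector.out
    TruncatedWittVector.truncateFun_out _ x

theorem TruncatedWittVector.isUnit_truncate_teichmuller {r : R} (hr : IsUnit r) :
    IsUnit (WittVector.truncate n (WittVector.teichmuller p r)) :=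
  (hr.map (WittVector.teichmuller p)).map (WittVector.truncate n)

/-- A truncated Witt vector over a localization away from `f` becomes integral after
multiplication by a power of `[f]`. -/
theorem TruncatedWittVector.exists_teichmuller_pow_mul_eq_map [Algebra R S] (f : R)
    [IsLocalization.Away f S] (z : TruncatedWittVector p n S) :
    ∃ (m : ℕ) (x : TruncatedWittVector p n R),
      z * truncatedWittVectorMap p n (algebraMap R S)
          (WittVector.truncate n (WittVector.teichmuller p f) ^ m) =
        truncatedWittVectorMap p n (algebraMap R S) x := by
  obtain ⟨z, rfl⟩ := WittVector.truncate_surjective p n S z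
  obtain ⟨⟨_, m, rfl⟩, hm⟩ := IsLocalization.exist_integer_multiples_of_finite
    (Submonoid.powers f) (fun i : Fin n => z.coeff i)
  choose a ha using hm
  refine ⟨m, WittVector.truncate n (WittVector.mk p fun k =>
    if hk : k < n then (f ^ m) ^ (p ^ k - 1) * a ⟨k, hk⟩ else 0), ?_⟩
  rw [← map_pow, ← map_pow, truncatedWittVectorMap_truncate, truncatedWittVectorMap_truncate,
    WittVector.map_teichmuller, ← map_mul, mul_comm]
  ext i
  have hi : (algebraMap R S (f ^ m)) ^ p ^ (i : ℕ) =
      (algebraMap R S (f ^ m)) ^ (p ^ (i : ℕ) - 1) * algebraMap R S (f ^ m) :=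
    (pow_sub_one_mul (pow_pos hp.1.pos _).ne' _).symm
  rw [WittVector.coeff_truncate, WittVector.coeff_truncate, WittVector.coeff_teichmuller_mul,
    WittVector.map_coeff, WittVector.coeff_mk, dif_pos i.2, map_mul, ha, Algebra.smul_def, hi,
    map_pow (algebraMap R S) (f ^ m), mul_assoc]

/-- Truncated Witt vectors with the same image over a localization away from `f` agree after
multiplication by a power of `[f]`. -/
theorem TruncatedWittVector.exists_teichmuller_pow_mul_eq [Algebra R S] (f : R)
    [IsLocalization.Away f S] {x y : TruncatedWittVector p n R}
    (h : truncatedWittVectorMap p n (algebraMap R S) x =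
      truncatedWittVectorMap p n (algebraMap R S) y) :
    ∃ m : ℕ, WittVector.truncate n (WittVector.teichmuller p f) ^ m * x =
      WittVector.truncate n (WittVector.teichmuller p f) ^ m * y := by
  obtain ⟨x, rfl⟩ := WittVector.truncate_surjective p n R x
  obtain ⟨y, rfl⟩ := WittVector.truncate_surjective p n R y
  rw [truncatedWittVectorMap_truncate, truncatedWittVectorMap_truncate] at h
  have hm (i : Fin n) : ∃ m : ℕ, f ^ m * x.coeff i = f ^ m * y.coeff i := by
    have hi := congrArg (TruncatedWittVector.coeff i) h
    rw [WittVector.coeff_truncate, WittVector.coeff_truncate, WittVector.map_coeff,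
      WittVector.map_coeff] at hi
    obtain ⟨⟨_, m, rfl⟩, hm⟩ := IsLocalization.exists_of_eq (M := Submonoid.powers f) hi
    exact ⟨m, hm⟩
  choose m hm using hm
  refine ⟨∑ i, m i, ?_⟩
  rw [← map_pow, ← map_pow, ← map_mul, ← map_mul]
  ext i
  rw [WittVector.coeff_truncate, WittVector.coeff_truncate, WittVector.coeff_teichmuller_mul,
    WittVector.coeff_teichmuller_mul, ← pow_mul]
  have hle : m i ≤ (∑ i, m i) * p ^ (i : ℕ) :=
    (Finset.single_le_sum (fun _ _ => Nat.zero_le _) (Finset.mem_univ i)).trans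
      (Nat.le_mul_of_pos_right _ (pow_pos hp.1.pos _))
  rw [← Nat.sub_add_cancel hle, pow_add, mul_assoc, mul_assoc, hm]

end TruncatedMap

/-- Let `p` be a prime, `n ≥ 1`, `R` a commutative ring and `f ∈ R`.
The ring homomorphism `W_n(R) → W_n(R[1/f])` induced by the localization map
`R → R[1/f]` sends the truncated Teichmüller representative `[f]` to a unit, and the
induced map `W_n(R)[1/[f]] → W_n(R[1/f])` is bijective; i.e. `W_n(R[1/f])` is the
localization of `W_n(R)` away from `[f]`. -/
theorem truncatedWittVector_localization_away
    (p : ℕ) [hp : Fact p.Prime] (n : ℕ) (hn : 1 ≤ n)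
    (R : Type*) [CommRing R] (f : R) :
    letI : Algebra (TruncatedWittVector p n R)
        (TruncatedWittVector p n (Localization.Away f)) :=
      (truncatedWittVectorMap p n (algebraMap R (Localization.Away f))).toAlgebra
    IsUnit (truncatedWittVectorMap p n (algebraMap R (Localization.Away f))
        (WittVector.truncate n (WittVector.teichmuller p f))) ∧
      IsLocalization.Away (WittVector.truncate n (WittVector.teichmuller p f))
        (TruncatedWittVector p n (Localization.Away f)) := by
  let : Algebra (TruncatedWittVector p n R) (TruncatedWittVector p n (Localization.Away f)) :=
    (truncatedWittVectorMap p n (algebraMap R (Localization.Away f))).toAlgebra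
  have hu : IsUnit (truncatedWittVectorMap p n (algebraMap R (Localization.Away f))
      (WittVector.truncate n (WittVector.teichmuller p f))) := by
    rw [truncatedWittVectorMap_truncate, WittVector.map_teichmuller]
    exact TruncatedWittVector.isUnit_truncate_teichmuller
      (IsLocalization.Away.algebraMap_isUnit f)
  refine ⟨hu, (isLocalization_iff _ _).mpr ⟨?_, fun z => ?_, fun {x y} h => ?_⟩⟩
  · rintro ⟨_, m, rfl⟩
    rw [RingHom.algebraMap_toAlgebra, map_pow]
    exact hu.pow m
  · obtain ⟨m, x, hx⟩ := TruncatedWittVector.exists_teichmuller_pow_mul_eq_map f z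
    exact ⟨⟨x, ⟨_, m, rfl⟩⟩, hx⟩
  · obtain ⟨m, hm⟩ := TruncatedWittVector.exists_teichmuller_pow_mul_eq f h
    exact ⟨⟨_, m, rfl⟩, hm⟩
end

section
/- Let p be a prime number, R a commutative ring, and J an ideal of R with p ∈ J such that R is J-adically complete. Then the map of multiplicative monoids lim_{x↦x^p} R → lim_{x↦x^p} (R/J), sending a sequence (a_k)_{k≥0} to the sequence of its reductions (a_k mod J)_{k≥0}, is bijective. (The inverse sends (b_k)_{k≥0} to the sequence whose k-th entry is the J-adic limit lim_{m→∞} (b̃_{k+m})^{p^m}, where b̃_j ∈ R is any lift of b_j.) -/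
/-- Let `p` be a prime, `R` a commutative ring, `J` an ideal of `R` with
`p ∈ J` such that `R` is `J`-adically complete.  Then the map of multiplicative monoids
`lim_{x ↦ x^p} R → lim_{x ↦ x^p} (R/J)`, sending a compatible sequence of `p`-th power
roots in `R` to the sequence of its reductions modulo `J`, is bijective. -/
theorem tilt_limit_bijective_of_adic_complete
    (p : ℕ) (hp : p.Prime) (R : Type*) [CommRing R]
    (J : Ideal R) (hpJ : (p : R) ∈ J) [IsAdicComplete J R] :
    Function.Bijective
      (fun a : {a : ℕ → R // ∀ k, a (k + 1) ^ p = a k} =>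
        (⟨fun k => Ideal.Quotient.mk J (a.1 k),
          fun k => by rw [← map_pow, a.2 k]⟩ :
          {b : ℕ → R ⧸ J // ∀ k, b (k + 1) ^ p = b k})) := by
  have : Fact p.Prime := ⟨hp⟩
  rcases eq_or_ne J ⊤ with rfl | hJ
  · have : Subsingleton R := IsAdicComplete.subsingleton R ‹_›
    exact ⟨fun _ _ _ => Subsingleton.elim _ _,
      fun b => ⟨⟨fun _ => 1, fun _ => one_pow p⟩, Subsingleton.elim _ _⟩⟩
  · have : Nontrivial (R ⧸ J) := Ideal.Quotient.nontrivial_iff.mpr hJ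
    have : CharP (R ⧸ J) p := (CharP.charP_iff_prime_eq_zero hp).mpr <| by
      simpa using Ideal.Quotient.eq_zero_iff_mem.mpr hpJ
    exact (Perfection.quotientMulEquiv p J).bijective
end

section
/- Let R be a ℚ^n-graded commutative ring and, for each i = 1, …, n, let f_i be a homogeneous element of degree q_i·e_i with q_i ∈ ℚ \ {0}; set 𝐟 := f_1⋯f_n. Then for every homogeneous prime ideal 𝔭 of R with 𝐟 ∉ 𝔭, the set 𝔭_(𝐟) := (𝔭·R[1/𝐟]) ∩ R_(𝐟) is a prime ideal of R_(𝐟), and the resulting map from the set of homogeneous prime ideals of R not containing 𝐟 to the prime spectrum Spec(R_(𝐟)) is a bijection. Moreover, this bijection is a homeomorphism, where the source carries the topology induced from the Zariski topology of Spec(R) and the target carries the Zariski topology of Spec(R_(𝐟)). -/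
open HomogeneousLocalization DirectSum

namespace HomogeneousPrimes

/-- Primality of a homogeneous ideal graded by a lexicographically orderable group can be tested
on homogeneous elements. -/
theorem isPrime_of_homogeneous_mem_or_mem_pi {α β : Type*} [LinearOrder α] [WellFoundedLT α]
    [AddCommGroup β] [LinearOrder β] [IsOrderedAddMonoid β] {A σ : Type*} [CommRing A]
    [inst : DecidableEq (α → β)] [SetLike σ A] [AddSubmonoidClass σ A]
    {𝒜 : (α → β) → σ} [grading : GradedRing 𝒜]
    {I : Ideal A} (hI : I.IsHomogeneous 𝒜) (hne : I ≠ ⊤)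
    (h : ∀ {x y : A}, SetLike.IsHomogeneousElem 𝒜 x → SetLike.IsHomogeneousElem 𝒜 y →
      x * y ∈ I → x ∈ I ∨ y ∈ I) : I.IsPrime := by
  let l : LinearOrder (Lex (α → β)) := inferInstance
  obtain rfl : inst = l.toDecidableEq := Subsingleton.elim _ _
  have hord : @IsOrderedCancelAddMonoid (Lex (α → β)) _ l.toPartialOrder.toPreorder :=
    inferInstance
  exact @Ideal.IsHomogeneous.isPrime_of_homogeneous_mem_or_mem (α → β) σ A _ inferInstance l hord _ _
    𝒜 grading I hI hne h

section General

variable {ι A σ : Type*} [AddCommGroup ι] [DecidableEq ι] [CommRing A] [SetLike σ A]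
  [AddSubgroupClass σ A] (𝒜 : ι → σ) [GradedRing 𝒜] {F : A} {D : ι} (hF : F ∈ 𝒜 D)

/-- The ideal `𝔭_(F) = (𝔭 · A[1/F]) ∩ A_(F)`. -/
abbrev awayIdeal (F : A) (𝔭 : Ideal A) : Ideal (Away 𝒜 F) :=
  Ideal.comap (algebraMap (Away 𝒜 F) (Localization.Away F))
    (Ideal.map (algebraMap A (Localization.Away F)) 𝔭)

theorem awayIdeal_isPrime {𝔭 : Ideal A} (h𝔭 : 𝔭.IsPrime) (hF𝔭 : F ∉ 𝔭) :
    (awayIdeal 𝒜 F 𝔭).IsPrime := by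
  have : (Ideal.map (algebraMap A (Localization.Away F)) 𝔭).IsPrime :=
    IsLocalization.isPrime_of_isPrime_disjoint (Submonoid.powers F) _ _ h𝔭
      ((Ideal.disjoint_powers_iff_notMem F h𝔭.isRadical).2 hF𝔭)
  exact Ideal.comap_isPrime _ _

include hF in
theorem mk_mem_awayIdeal_iff {𝔭 : Ideal A} (h𝔭 : 𝔭.IsPrime) (hF𝔭 : F ∉ 𝔭) {k : ℕ} {a : A}
    (ha : a ∈ 𝒜 (k • D)) : Away.mk 𝒜 hF k a ha ∈ awayIdeal 𝒜 F 𝔭 ↔ a ∈ 𝔭 := by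
  rw [Ideal.mem_comap, HomogeneousLocalization.algebraMap_apply, Away.val_mk,
    Localization.mk_eq_mk', IsLocalization.mk'_mem_map_algebraMap_iff]
  constructor
  · rintro ⟨_, ⟨m, rfl⟩, h⟩
    exact (h𝔭.mem_or_mem h).resolve_left fun h' ↦ hF𝔭 (h𝔭.mem_of_pow_mem _ h')
  · exact fun h ↦ ⟨1, one_mem _, by simpa using h⟩

/-- The degree `k • D` part of `a`, divided by `F ^ k`. -/
def fracPart (k : ℕ) : A →+ Away 𝒜 F where
  toFun a := Away.mk 𝒜 hF k (decompose 𝒜 a (k • D)) (SetLike.coe_mem _)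
  map_zero' := by
    apply HomogeneousLocalization.val_injective
    simp [Localization.mk_zero]
  map_add' a b := by
    apply HomogeneousLocalization.val_injective
    simp [Localization.add_mk_self]

variable {𝒜}

theorem val_fracPart (k : ℕ) (a : A) : (fracPart 𝒜 hF k a).val =
    Localization.mk (decompose 𝒜 a (k • D) : A)
      (⟨F ^ k, k, rfl⟩ : Submonoid.powers F) := rfl

theorem fracPart_of_mem {k : ℕ} {a : A} (ha : a ∈ 𝒜 (k • D)) :
    fracPart 𝒜 hF k a = Away.mk 𝒜 hF k a ha := by
  apply HomogeneousLocalization.val_injective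
  rw [val_fracPart, Away.val_mk, decompose_of_mem_same _ ha]

theorem fracPart_mul {k l : ℕ} {a b : A} (ha : a ∈ 𝒜 (k • D)) :
    fracPart 𝒜 hF (k + l) (a * b) = fracPart 𝒜 hF k a * fracPart 𝒜 hF l b := by
  apply HomogeneousLocalization.val_injective
  rw [val_mul, val_fracPart, val_fracPart, val_fracPart, add_smul,
    coe_decompose_mul_add_of_left_mem 𝒜 ha, decompose_of_mem_same _ ha, Localization.mk_mul]
  congr 1
  exact Subtype.ext (pow_add _ _ _)

theorem fracPart_pow (k : ℕ) : fracPart 𝒜 hF k (F ^ k) = 1 := by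
  apply HomogeneousLocalization.val_injective
  rw [val_fracPart, decompose_of_mem_same _ (SetLike.pow_mem_graded k hF), val_one]
  exact Localization.mk_self (⟨F ^ k, k, rfl⟩ : Submonoid.powers F)

theorem fracPart_mul_proj {d : ι} {k : ℕ} {a : A} (ha : a ∈ 𝒜 d) (c : A) :
    fracPart 𝒜 hF k (a * c) = fracPart 𝒜 hF k (a * decompose 𝒜 c (k • D - d)) := by
  have h := coe_decompose_mul_add_of_left_mem 𝒜 (j := k • D - d) (b := c) ha
  have h' := coe_decompose_mul_add_of_left_mem 𝒜 (j := k • D - d)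
    (b := (decompose 𝒜 c (k • D - d) : A)) ha
  rw [add_sub_cancel] at h h'
  apply HomogeneousLocalization.val_injective
  rw [val_fracPart, val_fracPart, h, h', decompose_of_mem_same _ (SetLike.coe_mem _)]

theorem fracPart_proj_mul (d : ι) (k : ℕ) (a c : A) :
    fracPart 𝒜 hF k (decompose 𝒜 a d * c) =
      fracPart 𝒜 hF k (a * decompose 𝒜 c (k • D - d)) := by
  rw [fracPart_mul_proj hF (SetLike.coe_mem _)]
  apply HomogeneousLocalization.val_injective
  have h := coe_decompose_mul_add_of_right_mem 𝒜 (i := d) (a := a)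
    (SetLike.coe_mem (decompose 𝒜 c (k • D - d)))
  rw [add_sub_cancel] at h
  have h' := coe_decompose_mul_add_of_right_mem 𝒜 (i := d) (a := (decompose 𝒜 a d : A))
    (SetLike.coe_mem (decompose 𝒜 c (k • D - d)))
  rw [add_sub_cancel] at h'
  rw [val_fracPart, val_fracPart, h, h', decompose_of_mem_same _ (SetLike.coe_mem _)]

/-- The largest homogeneous ideal of `A` whose extension to `A[1/F]` contracts into `𝔮`. -/
def liftIdeal (𝔮 : Ideal (Away 𝒜 F)) : Ideal A where
  carrier := {a | ∀ (k : ℕ) (c : A), fracPart 𝒜 hF k (a * c) ∈ 𝔮}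
  zero_mem' k c := by simp
  add_mem' ha hb k c := by
    rw [add_mul, map_add]
    exact 𝔮.add_mem (ha k c) (hb k c)
  smul_mem' r a ha k c := by
    rw [smul_eq_mul, mul_comm r, mul_assoc]
    exact ha k _

theorem mem_liftIdeal {𝔮 : Ideal (Away 𝒜 F)} {a : A} :
    a ∈ liftIdeal hF 𝔮 ↔ ∀ (k : ℕ) (c : A), fracPart 𝒜 hF k (a * c) ∈ 𝔮 := Iff.rfl

theorem liftIdeal_isHomogeneous (𝔮 : Ideal (Away 𝒜 F)) :
    (liftIdeal hF 𝔮).IsHomogeneous 𝒜 := by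
  intro d a ha k c
  rw [fracPart_proj_mul]
  exact ha k _

theorem mem_liftIdeal_iff_of_mem {𝔮 : Ideal (Away 𝒜 F)} {k : ℕ} {a : A} (ha : a ∈ 𝒜 (k • D)) :
    a ∈ liftIdeal hF 𝔮 ↔ Away.mk 𝒜 hF k a ha ∈ 𝔮 := by
  rw [mem_liftIdeal, ← fracPart_of_mem hF ha]
  refine ⟨fun h ↦ by simpa using h k 1, fun h l c ↦ ?_⟩
  have key : fracPart 𝒜 hF l (a * c) = fracPart 𝒜 hF (k + l) (F ^ k * (a * c)) := by
    rw [fracPart_mul hF (SetLike.pow_mem_graded k hF), fracPart_pow, one_mul]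
  rw [key, mul_left_comm, fracPart_mul hF ha]
  exact 𝔮.mul_mem_right _ h

theorem notMem_liftIdeal {𝔮 : Ideal (Away 𝒜 F)} (h𝔮 : 𝔮.IsPrime) : F ∉ liftIdeal hF 𝔮 := by
  intro h
  refine h𝔮.ne_top ((Ideal.eq_top_iff_one _).2 ?_)
  simpa [← fracPart_pow hF 1] using h 1 1

theorem mem_or_mem_liftIdeal {𝔮 : Ideal (Away 𝒜 F)} (h𝔮 : 𝔮.IsPrime) {a b : A}
    (ha : SetLike.IsHomogeneousElem 𝒜 a) (hab : a * b ∈ liftIdeal hF 𝔮) :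
    a ∈ liftIdeal hF 𝔮 ∨ b ∈ liftIdeal hF 𝔮 := by
  obtain ⟨d, ha⟩ := ha
  by_contra! h
  simp only [mem_liftIdeal, not_forall] at h
  obtain ⟨⟨k, c, hc⟩, l, c', hc'⟩ := h
  rw [fracPart_mul_proj hF ha] at hc
  refine (h𝔮.mem_or_mem ?_).elim hc hc'
  have hm : a * (decompose 𝒜 c (k • D - d) : A) ∈ 𝒜 (k • D) := by
    simpa using SetLike.mul_mem_graded ha (SetLike.coe_mem (decompose 𝒜 c (k • D - d)))
  rw [← fracPart_mul hF hm, mul_mul_mul_comm]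
  exact hab _ _

theorem awayIdeal_liftIdeal {𝔮 : Ideal (Away 𝒜 F)} (h𝔮 : 𝔮.IsPrime)
    (h : (liftIdeal hF 𝔮).IsPrime) : awayIdeal 𝒜 F (liftIdeal hF 𝔮) = 𝔮 := by
  ext z
  obtain ⟨k, a, ha, rfl⟩ := Away.mk_surjective 𝒜 hF z
  rw [mk_mem_awayIdeal_iff 𝒜 hF h (notMem_liftIdeal hF h𝔮), mem_liftIdeal_iff_of_mem hF ha]

variable (𝒜) in
include hF in
/-- If every homogeneous element has a power which, up to a divisor of a power of `F`, has degree a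
multiple of the degree of `F`, then membership in a prime avoiding `F` is detected by `A_(F)`. -/
theorem exists_mem_iff_mem_awayIdeal {a : A}
    (h : ∃ (N : ℕ) (g : A) (k M : ℕ), N ≠ 0 ∧ g ∣ F ^ M ∧ a ^ N * g ∈ 𝒜 (k • D)) :
    ∃ z : Away 𝒜 F, ∀ 𝔭 : Ideal A, 𝔭.IsPrime → F ∉ 𝔭 → (a ∈ 𝔭 ↔ z ∈ awayIdeal 𝒜 F 𝔭) := by
  obtain ⟨N, g, k, M, hN, hg, hag⟩ := h
  refine ⟨Away.mk 𝒜 hF k _ hag, fun 𝔭 h𝔭 hF𝔭 ↦ ?_⟩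
  have hg𝔭 : g ∉ 𝔭 := fun h ↦ hF𝔭 (h𝔭.mem_of_pow_mem _ (𝔭.mem_of_dvd hg h))
  rw [mk_mem_awayIdeal_iff 𝒜 hF h𝔭 hF𝔭, h𝔭.mul_mem_iff_mem_or_mem, or_iff_left hg𝔭,
    h𝔭.pow_mem_iff_mem N (Nat.pos_of_ne_zero hN)]

variable (𝒜) in
include hF in
theorem exists_homeomorph
    (hprime : ∀ I : Ideal A, I.IsHomogeneous 𝒜 → I ≠ ⊤ →
      (∀ {x y : A}, SetLike.IsHomogeneousElem 𝒜 x → SetLike.IsHomogeneousElem 𝒜 y →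
        x * y ∈ I → x ∈ I ∨ y ∈ I) → I.IsPrime)
    (hdeg : ∀ (d : ι) (a : A), a ∈ 𝒜 d →
      ∃ (N : ℕ) (g : A) (k M : ℕ), N ≠ 0 ∧ g ∣ F ^ M ∧ a ^ N * g ∈ 𝒜 (k • D)) :
    ∃ e : {𝔭 : PrimeSpectrum A // Ideal.IsHomogeneous 𝒜 𝔭.asIdeal ∧ F ∉ 𝔭.asIdeal} ≃ₜ
        PrimeSpectrum (Away 𝒜 F),
      ∀ 𝔭, (e 𝔭).asIdeal = awayIdeal 𝒜 F 𝔭.1.asIdeal := by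
  have hlift (𝔮 : PrimeSpectrum (Away 𝒜 F)) : (liftIdeal hF 𝔮.asIdeal).IsPrime :=
    hprime _ (liftIdeal_isHomogeneous hF _)
      (fun h ↦ notMem_liftIdeal hF 𝔮.2 (h ▸ Submodule.mem_top))
      (fun hx _ ↦ mem_or_mem_liftIdeal hF 𝔮.2 hx)
  choose z hz using fun d a ha ↦ exists_mem_iff_mem_awayIdeal 𝒜 hF (hdeg d a ha)
  let e : {𝔭 : PrimeSpectrum A // Ideal.IsHomogeneous 𝒜 𝔭.asIdeal ∧ F ∉ 𝔭.asIdeal} ≃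
      PrimeSpectrum (Away 𝒜 F) :=
    { toFun 𝔭 := ⟨awayIdeal 𝒜 F 𝔭.1.asIdeal, awayIdeal_isPrime 𝒜 𝔭.1.2 𝔭.2.2⟩
      invFun 𝔮 := ⟨⟨liftIdeal hF 𝔮.asIdeal, hlift 𝔮⟩, liftIdeal_isHomogeneous hF _,
        notMem_liftIdeal hF 𝔮.2⟩
      left_inv 𝔭 := by
        refine Subtype.ext (PrimeSpectrum.ext (Ideal.ext fun a ↦ ?_))
        have h𝔮 := awayIdeal_isPrime 𝒜 𝔭.1.2 𝔭.2.2
        rw [(liftIdeal_isHomogeneous hF _).mem_iff, 𝔭.2.1.mem_iff]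
        refine forall_congr' fun d ↦ ?_
        rw [hz d _ (SetLike.coe_mem _) _ (hlift ⟨_, h𝔮⟩) (notMem_liftIdeal hF h𝔮),
          awayIdeal_liftIdeal hF h𝔮 (hlift ⟨_, h𝔮⟩), ← hz d _ (SetLike.coe_mem _) _ 𝔭.1.2 𝔭.2.2]
      right_inv 𝔮 := PrimeSpectrum.ext (awayIdeal_liftIdeal hF 𝔮.2 (hlift 𝔮)) }
  refine ⟨⟨e, ?_, ?_⟩, fun _ ↦ rfl⟩
  · refine PrimeSpectrum.isTopologicalBasis_basic_opens.continuous_iff.2 ?_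
    rintro _ ⟨w, rfl⟩
    obtain ⟨k, a, ha, rfl⟩ := Away.mk_surjective 𝒜 hF w
    convert! (PrimeSpectrum.basicOpen a).isOpen.preimage continuous_subtype_val using 1
    ext 𝔭
    exact not_congr (mk_mem_awayIdeal_iff 𝒜 hF 𝔭.1.2 𝔭.2.2 ha)
  · refine Continuous.subtype_mk
      (PrimeSpectrum.isTopologicalBasis_basic_opens.continuous_iff.2 ?_) _
    rintro _ ⟨r, rfl⟩
    convert! isOpen_iUnion fun d ↦ (PrimeSpectrum.basicOpen
      (z d (decompose 𝒜 r d) (SetLike.coe_mem _))).isOpen using 1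
    ext 𝔮
    have hr := (liftIdeal_isHomogeneous hF 𝔮.asIdeal).mem_iff (x := r)
    simp only [Set.mem_iUnion, Set.mem_preimage, SetLike.mem_coe, PrimeSpectrum.mem_basicOpen]
    rw [← not_forall]
    refine not_congr (hr.trans (forall_congr' fun d ↦ ?_))
    rw [hz d _ (SetLike.coe_mem _) _ (hlift 𝔮) (notMem_liftIdeal hF 𝔮.2),
      awayIdeal_liftIdeal hF 𝔮.2 (hlift 𝔮)]

end General

theorem exists_pow_mul_mem_smul_sum_single {κ A σ : Type*} [Fintype κ] [DecidableEq κ]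
    [CommRing A] [SetLike σ A] [AddSubgroupClass σ A] [DecidableEq (κ → ℚ)]
    (𝒜 : (κ → ℚ) → σ) [GradedRing 𝒜] {f : κ → A} {q : κ → ℚ} (hq : ∀ i, q i ≠ 0)
    (hf : ∀ i, f i ∈ 𝒜 (q i • Pi.single i 1)) (d : κ → ℚ) (a : A) (ha : a ∈ 𝒜 d) :
    ∃ (N : ℕ) (g : A) (k M : ℕ), N ≠ 0 ∧ g ∣ (∏ i, f i) ^ M ∧
      a ^ N * g ∈ 𝒜 (k • ∑ i, q i • Pi.single i 1) := by
  let N : ℕ := ∏ i, (d i / q i).den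
  have hN : N ≠ 0 := Finset.prod_ne_zero_iff.2 fun i _ ↦ (d i / q i).den_nz
  have hm (i : κ) : ∃ m : ℤ, (N : ℚ) * d i = m * q i := by
    obtain ⟨c, hc⟩ : (d i / q i).den ∣ N := Finset.dvd_prod_of_mem _ (Finset.mem_univ i)
    refine ⟨c * (d i / q i).num, ?_⟩
    have h := Rat.den_mul_eq_num (d i / q i)
    rw [hc]
    push_cast
    rw [← h]
    field_simp [hq i]
  choose m hm using hm
  let k : ℕ := ∑ i, (m i).natAbs
  have hk (i : κ) : m i ≤ k := by
    have : (m i).natAbs ≤ k :=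
      Finset.single_le_sum (f := fun i ↦ (m i).natAbs) (fun _ _ ↦ Nat.zero_le _)
        (Finset.mem_univ i)
    lia
  let ε : κ → ℕ := fun i ↦ (k - m i).toNat
  have hε (i : κ) : (ε i : ℚ) = k - m i := by
    have : (ε i : ℤ) = k - m i := Int.toNat_of_nonneg (sub_nonneg.2 (hk i))
    exact_mod_cast this
  refine ⟨N, ∏ i, f i ^ ε i, k, ∑ i, ε i, hN, ?_, ?_⟩
  · rw [← Finset.prod_pow]
    exact Finset.prod_dvd_prod_of_dvd _ _ fun i hi ↦
      pow_dvd_pow _ (Finset.single_le_sum (f := ε) (fun _ _ ↦ Nat.zero_le _) hi)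
  · have h := SetLike.mul_mem_graded (SetLike.pow_mem_graded N ha)
      (SetLike.prod_mem_graded 𝒜 (fun i ↦ ε i • (q i • Pi.single i (1 : ℚ))) _
        fun i (_ : i ∈ Finset.univ) ↦ SetLike.pow_mem_graded (ε i) (hf i))
    convert h using 2
    ext j
    simp only [Pi.smul_apply, Pi.add_apply, Finset.sum_apply, nsmul_eq_mul, smul_eq_mul,
      Pi.single_apply, mul_ite, mul_one, mul_zero, Finset.sum_ite_eq, Finset.mem_univ, if_true,
      Pi.mul_apply, Pi.natCast_apply, hε, hm]
    ring

end HomogeneousPrimes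


/-- Let `R` be a `ℚ^n`-graded commutative ring and `f i` homogeneous of
degree `q i • e i` with `q i ≠ 0`; set `F := ∏ i, f i`.  For every homogeneous prime
`𝔭` of `R` with `F ∉ 𝔭`, the ideal `𝔭_(F) = (𝔭·R[1/F]) ∩ R_(F)` is prime, and
`𝔭 ↦ 𝔭_(F)` is a bijection from the homogeneous primes not containing `F` onto
`Spec R_(F)`, which is moreover a homeomorphism for the Zariski topologies. -/
theorem homogeneousPrimes_away_homeomorph_primeSpectrum
    (n : ℕ) (hn : 1 ≤ n) (R : Type*) [CommRing R]
    (𝒜 : (Fin n → ℚ) → Submodule ℤ R) [GradedAlgebra 𝒜]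
    (f : Fin n → R) (q : Fin n → ℚ) (hq : ∀ i, q i ≠ 0)
    (hf : ∀ i, f i ∈ 𝒜 (q i • (Pi.single i 1 : Fin n → ℚ)))
    (F : R) (hF : F = ∏ i, f i)
    (Q : {𝔭 : PrimeSpectrum R // Ideal.IsHomogeneous 𝒜 𝔭.asIdeal ∧ F ∉ 𝔭.asIdeal} →
      Ideal (HomogeneousLocalization.Away 𝒜 F))
    (hQ : ∀ 𝔭, Q 𝔭 =
      Ideal.comap
        (algebraMap (HomogeneousLocalization.Away 𝒜 F) (Localization.Away F))
        (Ideal.map (algebraMap R (Localization.Away F)) 𝔭.1.asIdeal)) :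
    (∀ 𝔭, (Q 𝔭).IsPrime) ∧
      ∃ e : {𝔭 : PrimeSpectrum R // Ideal.IsHomogeneous 𝒜 𝔭.asIdeal ∧ F ∉ 𝔭.asIdeal} ≃ₜ
          PrimeSpectrum (HomogeneousLocalization.Away 𝒜 F),
        ∀ 𝔭, (e 𝔭).asIdeal = Q 𝔭 := by
  obtain rfl : Q = fun 𝔭 ↦ HomogeneousPrimes.awayIdeal 𝒜 F 𝔭.1.asIdeal := funext hQ
  subst hF
  refine ⟨fun 𝔭 ↦ HomogeneousPrimes.awayIdeal_isPrime 𝒜 𝔭.1.2 𝔭.2.2, ?_⟩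
  exact HomogeneousPrimes.exists_homeomorph 𝒜
    (SetLike.prod_mem_graded 𝒜 _ _ fun i (_ : i ∈ Finset.univ) ↦ hf i)
    (fun _ ↦ HomogeneousPrimes.isPrime_of_homogeneous_mem_or_mem_pi)
    (HomogeneousPrimes.exists_pow_mul_mem_smul_sum_single 𝒜 hq hf)
end

section
/- Let R be a ℚ^n-graded commutative ring and, for each i = 1, …, n, let f_i be homogeneous of degree q_i·e_i and g_i homogeneous of degree r_i·e_i, where q_i and r_i are nonzero rationals of the same sign; set 𝐟 := f_1⋯f_n and 𝐠 := g_1⋯g_n. Then the subring of R_(𝐟𝐠) generated by the images of the canonical ring homomorphisms R_(𝐟) → R_(𝐟𝐠) and R_(𝐠) → R_(𝐟𝐠) (induced by the localization maps R[1/𝐟] → R[1/𝐟𝐠] and R[1/𝐠] → R[1/𝐟𝐠]) is all of R_(𝐟𝐠); equivalently, the induced ring homomorphism R_(𝐟) ⊗_ℤ R_(𝐠) → R_(𝐟𝐠) is surjective. -/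
/-- Finitely many nonnegative rationals have arbitrarily large common natural denominators. -/
lemma exists_nat_mul_eq_natCast {ι : Type*} [Fintype ι] (x : ι → ℚ) (hx : ∀ i, 0 ≤ x i) (k : ℕ) :
    ∃ m : ℕ, k ≤ m ∧ ∃ c : ι → ℕ, ∀ i, (c i : ℚ) = m * x i := by
  refine ⟨k * ∏ i, (x i).den, Nat.le_mul_of_pos_right _ (Finset.prod_pos fun i _ ↦ (x i).den_pos),
    ?_⟩
  have key (i : ι) : ∃ c : ℕ, (c : ℚ) = (k * ∏ i, (x i).den : ℕ) * x i := by
    obtain ⟨d, hd⟩ := Finset.dvd_prod_of_mem (fun i ↦ (x i).den) (Finset.mem_univ i)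
    refine ⟨k * d * (x i).num.toNat, ?_⟩
    have hnum : (((x i).num.toNat : ℕ) : ℚ) = x i * (x i).den := by
      rw [Rat.mul_den_eq_num]
      exact_mod_cast Int.toNat_of_nonneg (Rat.num_nonneg.mpr (hx i))
    rw [hd]
    push_cast
    rw [hnum]
    ring
  choose c hc using key
  exact ⟨c, hc⟩


/-- Let `R` be a `ℚ^n`-graded commutative ring, `f i` homogeneous of
degree `q i • e i` and `g i` homogeneous of degree `r i • e i`, with `q i`, `r i`
nonzero rationals of the same sign; set `F := ∏ i, f i` and `G := ∏ i, g i`.  Then the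
subring of `R_(FG)` generated by the images of the canonical ring homomorphisms
`R_(F) → R_(FG)` and `R_(G) → R_(FG)` is all of `R_(FG)`. -/
theorem homogeneousLocalization_away_mul_generated_by_images
    (n : ℕ) (hn : 1 ≤ n) (R : Type*) [CommRing R]
    (𝒜 : (Fin n → ℚ) → Submodule ℤ R) [GradedAlgebra 𝒜]
    (f g : Fin n → R) (q r : Fin n → ℚ)
    (hq : ∀ i, q i ≠ 0) (hr : ∀ i, r i ≠ 0)
    (hsign : ∀ i, 0 < q i * r i)
    (hf : ∀ i, f i ∈ 𝒜 (q i • (Pi.single i 1 : Fin n → ℚ)))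
    (hg : ∀ i, g i ∈ 𝒜 (r i • (Pi.single i 1 : Fin n → ℚ)))
    (hF : (∏ i, f i) ∈ 𝒜 (∑ i, q i • (Pi.single i 1 : Fin n → ℚ)))
    (hG : (∏ i, g i) ∈ 𝒜 (∑ i, r i • (Pi.single i 1 : Fin n → ℚ))) :
    Subring.closure
        (Set.range (HomogeneousLocalization.awayMap 𝒜 hG
            (rfl : (∏ i, f i) * (∏ i, g i) = (∏ i, f i) * (∏ i, g i))) ∪
          Set.range (HomogeneousLocalization.awayMap 𝒜 hF
            (mul_comm (∏ i, f i) (∏ i, g i)))) = ⊤ := by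
  classical
  refine eq_top_iff.mpr fun x _ ↦ ?_
  obtain ⟨k, a, ha, rfl⟩ :=
    HomogeneousLocalization.Away.mk_surjective 𝒜 (SetLike.mul_mem_graded hF hG) x
  obtain ⟨m, hkm, c, hc⟩ := exists_nat_mul_eq_natCast (fun i ↦ r i / q i)
    (fun i ↦ by
      rw [← mul_div_mul_left _ _ (hq i)]
      exact (div_pos (hsign i) (mul_self_pos.mpr (hq i))).le) k
  replace hc (i : Fin n) : (c i : ℚ) * q i = m * r i := by
    rw [hc, mul_assoc, div_mul_cancel₀ _ (hq i)]
  have hcs (i : Fin n) : c i ≤ ∑ j, c j :=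
    Finset.single_le_sum (fun _ _ ↦ Nat.zero_le _) (Finset.mem_univ i)
  obtain ⟨l, rfl⟩ := Nat.exists_eq_add_of_le hkm
  set s := ∑ j, c j
  have hb : a * (∏ i, f i ^ (s - c i)) * (∏ i, g i) ^ l ∈
      𝒜 ((k + s) • ∑ i, q i • (Pi.single i 1 : Fin n → ℚ)) := by
    have h := SetLike.mul_mem_graded (SetLike.mul_mem_graded ha
      (SetLike.prod_pow_mem_graded 𝒜 _ f (fun i ↦ s - c i) fun i (_ : i ∈ Finset.univ) ↦ hf i))
      (SetLike.pow_mem_graded l hG)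
    convert h using 2
    ext j
    have := hc j
    simp [Finset.sum_apply, Pi.single_apply, Nat.cast_sub (hcs j)] at this ⊢
    linear_combination this
  have hd : ∏ i, f i ^ c i ∈ 𝒜 ((k + l) • ∑ i, r i • (Pi.single i 1 : Fin n → ℚ)) := by
    have h := SetLike.prod_pow_mem_graded 𝒜 _ f c fun i (_ : i ∈ Finset.univ) ↦ hf i
    convert h using 2
    ext j
    have := hc j
    simp [Finset.sum_apply, Pi.single_apply] at this ⊢
    linear_combination -this
  have hprod : (∏ i, f i ^ (s - c i)) * ∏ i, f i ^ c i = (∏ i, f i) ^ s := by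
    rw [← Finset.prod_mul_distrib, ← Finset.prod_pow]
    exact Finset.prod_congr rfl fun i _ ↦ by rw [← pow_add, Nat.sub_add_cancel (hcs i)]
  convert Subring.mul_mem _
    (Subring.subset_closure (Set.mem_union_left _
      (Set.mem_range_self (HomogeneousLocalization.Away.mk 𝒜 hF _ _ hb))))
    (Subring.subset_closure (Set.mem_union_right _
      (Set.mem_range_self (HomogeneousLocalization.Away.mk 𝒜 hG _ _ hd)))) using 1
  apply HomogeneousLocalization.val_injective
  rw [HomogeneousLocalization.val_mul, HomogeneousLocalization.awayMap_mk,
    HomogeneousLocalization.awayMap_mk]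
  simp only [HomogeneousLocalization.Away.val_mk, Localization.mk_mul]
  rw [Localization.mk_eq_mk_iff, Localization.r_iff_exists]
  refine ⟨1, ?_⟩
  simp only [OneMemClass.coe_one, one_mul, Submonoid.coe_mul]
  linear_combination (-(a * (∏ i, g i) ^ (k + s + l + k) * (∏ i, f i) ^ (k + l + k))) * hprod
end

section
/- Let R be a ℚ^n-graded commutative ring and, for each i = 1, …, n, let f_i be homogeneous of degree q_i·e_i and g_i homogeneous of degree r_i·e_i, where q_i and r_i are nonzero rationals of the same sign; set 𝐟 := f_1⋯f_n and 𝐠 := g_1⋯g_n. Choose, for each i, positive integers a_i, b_i with a_i·r_i = b_i·q_i. Then u := (∏_{i=1}^n g_i^{a_i}) · (∏_{i=1}^n f_i^{b_i})^{-1} is a well-defined element of degree 0 of R[1/𝐟], i.e., u ∈ R_(𝐟); the image of u under the canonical ring homomorphism R_(𝐟) → R_(𝐟𝐠) is a unit; and the induced ring homomorphism R_(𝐟)[1/u] → R_(𝐟𝐠) is bijective. -/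
open HomogeneousLocalization in
/-- Let `F`, `G`, `P` be homogeneous elements such that `P` divides a power of `F` and a multiple
`G * C` of `G` has the same degree as `P` and divides a power of `G`, all cofactors being
homogeneous. Then `A_{(FG)}` is the localization of `A_{(F)}` away from `G * C / P`, which is
written here as `G * C * D / F ^ N` with `P * D = F ^ N`. -/
theorem HomogeneousLocalization.Away.isLocalization_mul_of_mul_eq_pow
    {ι A σ : Type*} [CommRing A] [SetLike σ A] [AddSubgroupClass σ A] [AddCommGroup ι]
    [DecidableEq ι] {𝒜 : ι → σ} [GradedRing 𝒜] {F G C P D E : A} {d e c δ ε : ι} {N M : ℕ}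
    (hF : F ∈ 𝒜 d) (hG : G ∈ 𝒜 e) (hC : C ∈ 𝒜 c) (hP : P ∈ 𝒜 (e + c))
    (hD : D ∈ 𝒜 δ) (hE : E ∈ 𝒜 ε) (hPD : P * D = F ^ N) (hGCE : G * C * E = G ^ M)
    (hδ : e + c + δ = N • d) (hε : e + c + ε = M • e)
    (hu : G * C * D ∈ 𝒜 (N • d)) :
    IsUnit (awayMap 𝒜 hG (rfl : F * G = F * G) (Away.mk 𝒜 hF N (G * C * D) hu)) ∧
      letI := (awayMap 𝒜 hG (rfl : F * G = F * G)).toAlgebra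
      IsLocalization.Away (Away.mk 𝒜 hF N (G * C * D) hu) (Away 𝒜 (F * G)) := by
  have hFG := SetLike.mul_mem_graded hF hG
  have hunit : IsUnit
      (awayMap 𝒜 hG (rfl : F * G = F * G) (Away.mk 𝒜 hF N (G * C * D) hu)) := by
    let z : Away 𝒜 (F * G) := Away.mk 𝒜 hFG M (P * E * F ^ M) <| by
      convert! SetLike.mul_mem_graded (SetLike.mul_mem_graded hP hE)
        (SetLike.pow_mem_graded M hF) using 2
      rw [hε, smul_add, add_comm]
    refine isUnit_iff_exists_inv.mpr ⟨z, ?_⟩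
    ext
    simp only [val_mul, val_one, awayMap_mk, Away.val_mk, z, Localization.mk_mul]
    rw [← Localization.mk_one, Localization.mk_eq_mk_iff, Localization.r_iff_exists]
    use 1
    simp only [OneMemClass.coe_one, one_mul, Submonoid.coe_mul, mul_one]
    linear_combination G ^ N * F ^ M * (P * D * hGCE + G ^ M * hPD)
  refine ⟨hunit, ?_⟩
  let := (awayMap 𝒜 hG (rfl : F * G = F * G)).toAlgebra
  constructor; constructor
  · rintro ⟨r, n, rfl⟩
    rw [map_pow, RingHom.algebraMap_toAlgebra]
    exact hunit.pow _
  · intro z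
    obtain ⟨n, s, hs, rfl⟩ := Away.mk_surjective 𝒜 hFG z
    let t : Away 𝒜 F := Away.mk 𝒜 hF (n + n * N) (s * C ^ n * D ^ n) <| by
      convert! SetLike.mul_mem_graded (SetLike.mul_mem_graded hs (SetLike.pow_mem_graded n hC))
        (SetLike.pow_mem_graded n hD) using 2
      rw [add_smul, mul_smul, ← hδ]
      simp only [smul_add]
      abel
    refine ⟨⟨t, ⟨_, ⟨n, rfl⟩⟩⟩, ?_⟩
    ext
    simp only [RingHom.algebraMap_toAlgebra, map_pow, awayMap_mk, val_mul, Away.val_mk, val_pow,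
      Localization.mk_pow, Localization.mk_mul, t]
    rw [Localization.mk_eq_mk_iff, Localization.r_iff_exists]
    exact ⟨1, by simp; ring⟩
  · intro a b h
    obtain ⟨n, a, ha, rfl⟩ := Away.mk_surjective 𝒜 hF a
    obtain ⟨m, b, hb, rfl⟩ := Away.mk_surjective 𝒜 hF b
    replace h := congr_arg val h
    simp only [RingHom.algebraMap_toAlgebra, awayMap_mk, Away.val_mk,
      Localization.mk_eq_mk_iff, Localization.r_iff_exists] at h
    obtain ⟨⟨_, k, rfl⟩, hc⟩ := h
    refine ⟨⟨_, k + m + n, rfl⟩, ?_⟩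
    ext
    simp only [val_mul, val_pow, Away.val_mk, Localization.mk_pow,
      Localization.mk_eq_mk_iff, Localization.r_iff_exists, Submonoid.coe_mul, Localization.mk_mul,
      SubmonoidClass.coe_pow, Subtype.exists, exists_prop]
    refine ⟨_, ⟨k, rfl⟩, ?_⟩
    linear_combination (C * D) ^ (k + m + n) * F ^ (N * (k + m + n)) * hc


/-- With `f i` homogeneous of degree `q i • e i` and `g i` of degree
`r i • e i` (`q i`, `r i` nonzero of the same sign), `F := ∏ i, f i`, `G := ∏ i, g i`,
and positive integers `a i`, `b i` with `a i · r i = b i · q i`, the element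
`u := (∏ i, g i ^ a i) · (∏ i, f i ^ b i)⁻¹` of `R[1/F]` has degree `0`, i.e. lies in
`R_(F)` (characterized by `u · (∏ f_i^{b_i}) = ∏ g_i^{a_i}` in `R[1/F]`); its image in
`R_(FG)` under the canonical map is a unit; and the induced ring homomorphism
`R_(F)[1/u] → R_(FG)` is bijective, i.e. `R_(FG)` is the localization of `R_(F)` away
from `u`. -/
theorem homogeneousLocalization_away_mul_isLocalization_away
    (n : ℕ) (hn : 1 ≤ n) (R : Type*) [CommRing R]
    (𝒜 : (Fin n → ℚ) → Submodule ℤ R) [GradedAlgebra 𝒜]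
    (f g : Fin n → R) (q r : Fin n → ℚ)
    (hq : ∀ i, q i ≠ 0) (hr : ∀ i, r i ≠ 0)
    (hsign : ∀ i, 0 < q i * r i)
    (hf : ∀ i, f i ∈ 𝒜 (q i • (Pi.single i 1 : Fin n → ℚ)))
    (hg : ∀ i, g i ∈ 𝒜 (r i • (Pi.single i 1 : Fin n → ℚ)))
    (hG : (∏ i, g i) ∈ 𝒜 (∑ i, r i • (Pi.single i 1 : Fin n → ℚ)))
    (a b : Fin n → ℕ) (ha : ∀ i, 0 < a i) (hb : ∀ i, 0 < b i)
    (hab : ∀ i, (a i : ℚ) * r i = (b i : ℚ) * q i) :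
    ∃ u : HomogeneousLocalization.Away 𝒜 (∏ i, f i),
      u.val * algebraMap R (Localization.Away (∏ i, f i)) (∏ i, f i ^ b i) =
          algebraMap R (Localization.Away (∏ i, f i)) (∏ i, g i ^ a i) ∧
        IsUnit (HomogeneousLocalization.awayMap 𝒜 hG
          (rfl : (∏ i, f i) * (∏ i, g i) = (∏ i, f i) * (∏ i, g i)) u) ∧
        (letI : Algebra (HomogeneousLocalization.Away 𝒜 (∏ i, f i))
            (HomogeneousLocalization.Away 𝒜 ((∏ i, f i) * (∏ i, g i))) :=
          (HomogeneousLocalization.awayMap 𝒜 hG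
            (rfl : (∏ i, f i) * (∏ i, g i) = (∏ i, f i) * (∏ i, g i))).toAlgebra
        IsLocalization.Away u
          (HomogeneousLocalization.Away 𝒜 ((∏ i, f i) * (∏ i, g i)))) := by
  classical
  have hF : ∏ i, f i ∈ 𝒜 (∑ i, q i • (Pi.single i 1 : Fin n → ℚ)) :=
    SetLike.prod_mem_graded _ _ _ fun i _ ↦ hf i
  have hbN (i) : b i ≤ ∑ j, b j := Finset.single_le_sum_of_canonicallyOrdered (Finset.mem_univ i)
  have haM (i) : a i ≤ ∑ j, a j := Finset.single_le_sum_of_canonicallyOrdered (Finset.mem_univ i)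
  have hC := SetLike.prod_pow_mem_graded 𝒜 _ g (fun i ↦ a i - 1)
    fun i (_ : i ∈ Finset.univ) ↦ hg i
  have hP := SetLike.prod_pow_mem_graded 𝒜 _ f b fun i (_ : i ∈ Finset.univ) ↦ hf i
  have hD := SetLike.prod_pow_mem_graded 𝒜 _ f (fun i ↦ ∑ j, b j - b i)
    fun i (_ : i ∈ Finset.univ) ↦ hf i
  have hE := SetLike.prod_pow_mem_graded 𝒜 _ g (fun i ↦ ∑ j, a j - a i)
    fun i (_ : i ∈ Finset.univ) ↦ hg i
  have hGC : (∏ i, g i) * ∏ i, g i ^ (a i - 1) = ∏ i, g i ^ a i := by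
    rw [← Finset.prod_mul_distrib]
    exact Finset.prod_congr rfl fun i _ ↦ mul_pow_sub_one (ha i).ne' _
  have hPD : (∏ i, f i ^ b i) * ∏ i, f i ^ (∑ j, b j - b i) = (∏ i, f i) ^ ∑ j, b j := by
    rw [← Finset.prod_mul_distrib, ← Finset.prod_pow]
    exact Finset.prod_congr rfl fun i _ ↦ pow_mul_pow_sub _ (hbN i)
  have hGCE : (∏ i, g i) * (∏ i, g i ^ (a i - 1)) * ∏ i, g i ^ (∑ j, a j - a i) =
      (∏ i, g i) ^ ∑ j, a j := by
    rw [hGC, ← Finset.prod_mul_distrib, ← Finset.prod_pow]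
    exact Finset.prod_congr rfl fun i _ ↦ pow_mul_pow_sub _ (haM i)
  have hdegQ : (∑ i, r i • (Pi.single i 1 : Fin n → ℚ)) +
      ∑ i, (a i - 1) • r i • (Pi.single i 1 : Fin n → ℚ) =
      ∑ i, a i • r i • (Pi.single i 1 : Fin n → ℚ) := by
    rw [← Finset.sum_add_distrib]
    refine Finset.sum_congr rfl fun i _ ↦ ?_
    rw [← succ_nsmul', Nat.sub_add_cancel (ha i)]
  have hdegPQ : ∑ i, b i • q i • (Pi.single i 1 : Fin n → ℚ) =
      ∑ i, a i • r i • (Pi.single i 1 : Fin n → ℚ) := by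
    refine Finset.sum_congr rfl fun i _ ↦ ?_
    rw [← Nat.cast_smul_eq_nsmul ℚ, ← Nat.cast_smul_eq_nsmul ℚ, smul_smul, smul_smul, hab]
  have hδ : (∑ i, r i • (Pi.single i 1 : Fin n → ℚ)) +
      (∑ i, (a i - 1) • r i • (Pi.single i 1 : Fin n → ℚ)) +
      ∑ i, (∑ j, b j - b i) • q i • (Pi.single i 1 : Fin n → ℚ) =
      (∑ j, b j) • ∑ i, q i • (Pi.single i 1 : Fin n → ℚ) := by
    rw [hdegQ, ← hdegPQ, ← Finset.sum_add_distrib, Finset.smul_sum]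
    refine Finset.sum_congr rfl fun i _ ↦ ?_
    rw [← add_smul, Nat.add_sub_cancel' (hbN i)]
  have hε : (∑ i, r i • (Pi.single i 1 : Fin n → ℚ)) +
      (∑ i, (a i - 1) • r i • (Pi.single i 1 : Fin n → ℚ)) +
      ∑ i, (∑ j, a j - a i) • r i • (Pi.single i 1 : Fin n → ℚ) =
      (∑ j, a j) • ∑ i, r i • (Pi.single i 1 : Fin n → ℚ) := by
    rw [hdegQ, ← Finset.sum_add_distrib, Finset.smul_sum]
    refine Finset.sum_congr rfl fun i _ ↦ ?_
    rw [← add_smul, Nat.add_sub_cancel' (haM i)]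
  have hu := hδ ▸ SetLike.mul_mem_graded (SetLike.mul_mem_graded hG hC) hD
  rw [hdegPQ, ← hdegQ] at hP
  refine ⟨HomogeneousLocalization.Away.mk 𝒜 hF _ _ hu, ?_,
    HomogeneousLocalization.Away.isLocalization_mul_of_mul_eq_pow
      hF hG hC hP hD hE hPD hGCE hδ hε hu⟩
  rw [HomogeneousLocalization.Away.val_mk, ← Localization.mk_one_eq_algebraMap,
    ← Localization.mk_one_eq_algebraMap, Localization.mk_mul, Localization.mk_eq_mk_iff,
    Localization.r_iff_exists]
  refine ⟨1, ?_⟩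
  simp only [OneMemClass.coe_one, one_mul, mul_one]
  rw [hGC, mul_assoc, mul_comm (∏ i, f i ^ (∑ j, b j - b i)), hPD, mul_comm]
end

section
/- Let R be a ℚ^n-graded commutative ring and, for each i = 1, …, n, let f_i be homogeneous of degree q_i·e_i and g_i homogeneous of degree r_i·e_i, where q_i and r_i are nonzero rationals of the same sign; set 𝐟 := f_1⋯f_n and 𝐠 := g_1⋯g_n. Choose, for each i, positive integers a_i, b_i with a_i·r_i = b_i·q_i, and let u := (∏_{i=1}^n g_i^{a_i}) · (∏_{i=1}^n f_i^{b_i})^{-1} ∈ R_(𝐟). Then for every homogeneous prime ideal 𝔭 of R with 𝐟 ∉ 𝔭, one has 𝐠 ∉ 𝔭 if and only if u ∉ 𝔭_(𝐟), where 𝔭_(𝐟) := (𝔭·R[1/𝐟]) ∩ R_(𝐟). -/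
/-- With `f i` homogeneous of degree `q i • e i`, `g i` of degree
`r i • e i` (`q i`, `r i` nonzero of the same sign), `F := ∏ i, f i`, `G := ∏ i, g i`,
positive integers `a i`, `b i` with `a i · r i = b i · q i`, and
`u := (∏ i, g i ^ a i) · (∏ i, f i ^ b i)⁻¹ ∈ R_(F)` (characterized by
`u · (∏ f_i^{b_i}) = ∏ g_i^{a_i}` in `R[1/F]`): for every homogeneous prime `𝔭` of `R`
with `F ∉ 𝔭`, one has `G ∉ 𝔭` if and only if `u ∉ 𝔭_(F)`, where
`𝔭_(F) := (𝔭·R[1/F]) ∩ R_(F)`. -/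
theorem not_mem_iff_unit_not_mem_degreeZeroPart
    (n : ℕ) (hn : 1 ≤ n) (R : Type*) [CommRing R]
    (𝒜 : (Fin n → ℚ) → Submodule ℤ R) [GradedAlgebra 𝒜]
    (f g : Fin n → R) (q r : Fin n → ℚ)
    (hq : ∀ i, q i ≠ 0) (hr : ∀ i, r i ≠ 0)
    (hsign : ∀ i, 0 < q i * r i)
    (hf : ∀ i, f i ∈ 𝒜 (q i • (Pi.single i 1 : Fin n → ℚ)))
    (hg : ∀ i, g i ∈ 𝒜 (r i • (Pi.single i 1 : Fin n → ℚ)))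
    (a b : Fin n → ℕ) (ha : ∀ i, 0 < a i) (hb : ∀ i, 0 < b i)
    (hab : ∀ i, (a i : ℚ) * r i = (b i : ℚ) * q i)
    (u : HomogeneousLocalization.Away 𝒜 (∏ i, f i))
    (hu : u.val * algebraMap R (Localization.Away (∏ i, f i)) (∏ i, f i ^ b i) =
      algebraMap R (Localization.Away (∏ i, f i)) (∏ i, g i ^ a i)) :
    ∀ 𝔭 : Ideal R, 𝔭.IsPrime → Ideal.IsHomogeneous 𝒜 𝔭 → (∏ i, f i) ∉ 𝔭 →
      ((∏ i, g i) ∉ 𝔭 ↔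
        u ∉ Ideal.comap
          (algebraMap (HomogeneousLocalization.Away 𝒜 (∏ i, f i))
            (Localization.Away (∏ i, f i)))
          (Ideal.map (algebraMap R (Localization.Away (∏ i, f i))) 𝔭)) := by
  intro 𝔭 h𝔭 _ hF
  have hdisj : Disjoint (Submonoid.powers (∏ i, f i) : Set R) (𝔭 : Set R) :=
    (Ideal.disjoint_powers_iff_notMem _ h𝔭.isRadical).2 hF
  have hunit : IsUnit (algebraMap R (Localization.Away (∏ i, f i)) (∏ i, f i ^ b i)) := by
    have hprod := IsLocalization.Away.algebraMap_isUnit (S := Localization.Away (∏ i, f i))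
      (∏ i, f i)
    rw [map_prod, IsUnit.prod_univ_iff] at hprod
    rw [map_prod, IsUnit.prod_univ_iff]
    intro i
    rw [map_pow]
    exact (hprod i).pow _
  rw [not_iff_not, Ideal.mem_comap, HomogeneousLocalization.algebraMap_apply,
    ← Ideal.mul_unit_mem_iff_mem _ hunit, hu, ← Ideal.mem_comap, ← Ideal.under_def,
    IsLocalization.under_map_of_isPrime_disjoint (Submonoid.powers (∏ i, f i)) _ h𝔭 hdisj,
    Ideal.IsPrime.prod_mem_iff, Ideal.IsPrime.prod_mem_iff]
  simp only [Finset.mem_univ, true_and, h𝔭.pow_mem_iff_mem _ (ha _)]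
end
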